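/- arXiv:2203.15761 — 2 statements merged into one kernel-verified Lean document; each statement's English description precedes it below -/
import Mathlib

section
/- Fix an integer k >= 1 and let P(R^k) be the space of Borel probability measures on R^k equipped with the topology of weak convergence. The set D of all probability measures on R^k that belong to the multivariate maximum domain of attraction is a set of the first Baire category (i.e., meagre) in P(R^k). -/
open MeasureTheory Filter Topology Set NNReal

/-- The multivariate cumulative distribution function of a Borel probability measure on `ℝ^k`:
`F(x) = μ(∏ i, (-∞, x i])`. -/
noncomputable def mdistrib {k : ℕ} (μ : ProbabilityMeasure (Fin k → ℝ)) (x : Fin k → ℝ) : ℝ :=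
  (μ (Set.Iic x) : ℝ≥0)

/-- `μ` belongs to the multivariate maximum domain of attraction: there are affine
normalizations `x ↦ α n * x + β n` (componentwise, with positive slopes) and a limit
distribution `G` with all one-dimensional marginals nondegenerate such that
`(F (α n * x + β n)) ^ n → G x` at every continuity point `x` of `G`. -/
def MemMultiDomAttr {k : ℕ} (μ : ProbabilityMeasure (Fin k → ℝ)) : Prop :=
  ∃ α β : ℕ → Fin k → ℝ, (∀ n i, 0 < α n i) ∧
    ∃ G : ProbabilityMeasure (Fin k → ℝ),
      (∀ i : Fin k, ∀ c : ℝ, (G : Measure (Fin k → ℝ)).map (fun y => y i) ≠ Measure.dirac c) ∧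
      ∀ x : Fin k → ℝ, ContinuousAt (mdistrib G) x →
        Tendsto (fun n : ℕ => mdistrib μ (fun i => α n i * x i + β n i) ^ n) atTop
          (𝓝 (mdistrib G x))


/-- One-dimensional marginal distribution function. -/
noncomputable def margCdf {k : ℕ} (ν : ProbabilityMeasure (Fin k → ℝ)) (i : Fin k) (t : ℝ) : ℝ :=
  (ν : Measure (Fin k → ℝ)).real {ω | ω i ≤ t}

lemma mdistrib_eq {k : ℕ} (ν : ProbabilityMeasure (Fin k → ℝ)) (x : Fin k → ℝ) :
    mdistrib ν x = (ν : Measure (Fin k → ℝ)).real (Set.Iic x) := by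
  simp [mdistrib]

lemma pow_aux {p p1 q : ℝ} (hp : 0 ≤ p) (hpp : p ≤ p1) (h1 : p1 ≤ 1) (hpq : p ≤ q)
    (hq : q ≤ 1) (h : p1 ≤ p + 1 - q) (n : ℕ) : p1 ^ n ≤ p ^ n + 1 - q ^ n := by
  induction n with
  | zero => simp
  | succ n ih =>
    have a1 : p ^ n ≤ q ^ n := pow_le_pow_left₀ hp hpq n
    have a2 : q ^ n ≤ 1 := pow_le_one₀ (hp.trans hpq) hq
    have a3 : 0 ≤ p ^ n := pow_nonneg hp n
    have e1 : p1 ^ (n+1) - p ^ (n+1) = p1 * (p1 ^ n - p ^ n) + (p1 - p) * p ^ n := by ring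
    have e2 : 1 - q ^ (n+1) = (1 - q ^ n) + q ^ n * (1 - q) := by ring
    have b1 : p1 * (p1 ^ n - p ^ n) ≤ p1 * (1 - q ^ n) :=
      mul_le_mul_of_nonneg_left (by linarith) (by linarith)
    have b2 : p1 * (1 - q ^ n) ≤ 1 - q ^ n := mul_le_of_le_one_left (by linarith) h1
    have b3 : (p1 - p) * p ^ n ≤ (1 - q) * p ^ n :=
      mul_le_mul_of_nonneg_right (by linarith) a3
    have b4 : (1 - q) * p ^ n ≤ (1 - q) * q ^ n :=
      mul_le_mul_of_nonneg_left a1 (by linarith)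
    nlinarith

lemma meas_le {k : ℕ} (i : Fin k) (t : ℝ) : MeasurableSet {ω : Fin k → ℝ | ω i ≤ t} :=
  measurableSet_le (measurable_pi_apply i) measurable_const

lemma marg_le {k : ℕ} (ν : ProbabilityMeasure (Fin k → ℝ)) (i : Fin k) (u w : Fin k → ℝ)
    (h : ∀ j, j ≠ i → u j = w j) :
    margCdf ν i (u i) ≤ mdistrib ν u + 1 - mdistrib ν w := by
  have hsub : {ω : Fin k → ℝ | ω i ≤ u i} ⊆ Set.Iic u ∪ (Set.Iic w)ᶜ := by
    intro ω hω
    by_cases hw : ω ∈ Set.Iic w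
    · left
      intro j
      by_cases hj : j = i
      · subst hj; exact hω
      · rw [h j hj]; exact hw j
    · right; exact hw
  have h1 := measureReal_mono (μ := (ν : Measure (Fin k → ℝ))) hsub
  have h2 := measureReal_union_le (μ := (ν : Measure (Fin k → ℝ))) (Set.Iic u) (Set.Iic w)ᶜ
  rw [probReal_compl_eq_one_sub measurableSet_Iic] at h2
  rw [mdistrib_eq, mdistrib_eq, margCdf]
  linarith

lemma le_marg {k : ℕ} (ν : ProbabilityMeasure (Fin k → ℝ)) (i : Fin k) (u : Fin k → ℝ) :
    mdistrib ν u ≤ margCdf ν i (u i) := by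
  rw [mdistrib_eq, margCdf]
  exact measureReal_mono (fun ω hω => hω i)

lemma mdistrib_mono {k : ℕ} (ν : ProbabilityMeasure (Fin k → ℝ)) : Monotone (mdistrib ν) := by
  intro u w h
  rw [mdistrib_eq, mdistrib_eq]
  exact measureReal_mono (Set.Iic_subset_Iic.2 h)

lemma mdistrib_nonneg {k : ℕ} (ν : ProbabilityMeasure (Fin k → ℝ)) (u) : 0 ≤ mdistrib ν u := by
  rw [mdistrib_eq]; exact measureReal_nonneg

lemma mdistrib_le_one {k : ℕ} (ν : ProbabilityMeasure (Fin k → ℝ)) (u) : mdistrib ν u ≤ 1 := by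
  rw [mdistrib_eq]; exact measureReal_le_one

lemma marg_nonneg {k : ℕ} (ν : ProbabilityMeasure (Fin k → ℝ)) (i t) : 0 ≤ margCdf ν i t :=
  measureReal_nonneg

lemma marg_le_one {k : ℕ} (ν : ProbabilityMeasure (Fin k → ℝ)) (i t) : margCdf ν i t ≤ 1 :=
  measureReal_le_one

lemma cont_aux {k : ℕ} (ν : ProbabilityMeasure (Fin k → ℝ)) (x : Fin k → ℝ)
    (h : ∀ i, (ν : Measure (Fin k → ℝ)) {ω | ω i = x i} = 0) :
    ContinuousAt (mdistrib ν) x := by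
  have e : mdistrib ν = fun x => (ν : Measure (Fin k → ℝ)).real (Set.Iic x) := by
    funext x; exact mdistrib_eq ν x
  rw [e]
  unfold ContinuousAt Measure.real
  refine (ENNReal.tendsto_toReal (by finiteness)).comp ?_
  apply tendsto_measure_of_ae_tendsto_indicator_of_isFiniteMeasure
  · exact measurableSet_Iic
  · intro _; exact measurableSet_Iic
  · have : ∀ᵐ ω ∂(ν : Measure (Fin k → ℝ)), ∀ i, ω i ≠ x i := by
      rw [ae_all_iff]
      intro i
      rw [ae_iff]
      simpa using h i
    filter_upwards [this] with ω hω
    have : ∀ i, ∀ᶠ y : Fin k → ℝ in 𝓝 x, (ω i ≤ y i ↔ ω i ≤ x i) := by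
      intro i
      have hc : Tendsto (fun y : Fin k → ℝ => y i) (𝓝 x) (𝓝 (x i)) :=
        (continuous_apply i).tendsto x
      rcases lt_or_gt_of_ne (hω i) with hl | hl
      · filter_upwards [hc.eventually (lt_mem_nhds hl)] with y hy
        exact ⟨fun _ => hl.le, fun _ => hy.le⟩
      · filter_upwards [hc.eventually (gt_mem_nhds hl)] with y hy
        exact ⟨fun h => absurd h (not_le.2 hy), fun h => absurd h (not_le.2 hl)⟩
    filter_upwards [eventually_all.2 this] with y hy
    simp only [Set.mem_Iic, Pi.le_def]
    exact forall_congr' hy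

lemma top_aux {k : ℕ} (ν : ProbabilityMeasure (Fin k → ℝ)) (ε : ℝ) (hε : 0 < ε) :
    ∃ R0 : ℝ, ∀ R, R0 ≤ R → 1 - ε < mdistrib ν (fun _ => R) := by
  have hm : Monotone (fun R : ℝ => (Set.Iic (fun _ => R) : Set (Fin k → ℝ))) := by
    intro a b h
    exact Set.Iic_subset_Iic.2 (fun _ => h)
  have ht := tendsto_measure_iUnion_atTop (μ := (ν : Measure (Fin k → ℝ))) hm
  have hu : (⋃ R : ℝ, (Set.Iic (fun _ => R) : Set (Fin k → ℝ))) = Set.univ := by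
    rw [Set.eq_univ_iff_forall]
    intro ω
    rw [Set.mem_iUnion]
    exact ⟨∑ i, |ω i|, fun i => (le_abs_self _).trans
      (Finset.single_le_sum (f := fun i => |ω i|) (fun _ _ => abs_nonneg _) (Finset.mem_univ i))⟩
  rw [hu, measure_univ] at ht
  have ht2 := (ENNReal.tendsto_toReal ENNReal.one_ne_top).comp ht
  have := ht2.eventually (lt_mem_nhds (a := 1 - ε) (by simpa using hε))
  obtain ⟨R0, h0⟩ := eventually_atTop.1 this
  refine ⟨R0, fun R hR => ?_⟩
  rw [mdistrib_eq]
  exact h0 R hR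

/-- bad points -/
def badSet {k : ℕ} (ν : ProbabilityMeasure (Fin k → ℝ)) : Set ℝ :=
  ⋃ i : Fin k, {t | 0 < (ν : Measure (Fin k → ℝ)) {ω | ω i = t}}

lemma badSet_countable {k : ℕ} (ν : ProbabilityMeasure (Fin k → ℝ)) : (badSet ν).Countable :=
  Set.countable_iUnion fun i => Measure.countable_meas_level_set_pos (measurable_pi_apply i)

lemma exists_good {k : ℕ} (ν : ProbabilityMeasure (Fin k → ℝ)) {a b : ℝ} (h : a < b) :
    ∃ t, a < t ∧ t < b ∧ t ∉ badSet ν := by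
  have hd : Dense (badSet ν)ᶜ := (badSet_countable ν).dense_compl ℝ
  obtain ⟨t, ht, h1⟩ := hd.exists_between h
  exact ⟨t, h1.1, h1.2, ht⟩

lemma cont_of_good {k : ℕ} (ν : ProbabilityMeasure (Fin k → ℝ)) (x : Fin k → ℝ)
    (h : ∀ i, x i ∉ badSet ν) : ContinuousAt (mdistrib ν) x := by
  apply cont_aux
  intro i
  by_contra hne
  exact h i (Set.mem_iUnion.2 ⟨i, pos_iff_ne_zero.2 hne⟩)

/-- Convergence of marginals. -/
lemma marg_tendsto {k : ℕ} (μ G : ProbabilityMeasure (Fin k → ℝ)) (α β : ℕ → Fin k → ℝ)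
    (hα : ∀ n i, 0 < α n i)
    (h : ∀ x : Fin k → ℝ, ContinuousAt (mdistrib G) x →
        Tendsto (fun n : ℕ => mdistrib μ (fun i => α n i * x i + β n i) ^ n) atTop
          (𝓝 (mdistrib G x))) (i : Fin k) (t : ℝ) (ht : t ∉ badSet G) :
    Tendsto (fun n : ℕ => margCdf μ i (α n i * t + β n i) ^ n) atTop (𝓝 (margCdf G i t)) := by
  rw [Metric.tendsto_atTop']
  intro ε hε
  obtain ⟨R0, hR0⟩ := top_aux G (ε/4) (by linarith)
  obtain ⟨R, hR1, -, hR⟩ := exists_good G (lt_add_one (max R0 t))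
  have hRG := hR0 R ((le_max_left _ _).trans hR1.le)
  have hRt : t ≤ R := (le_max_right _ _).trans hR1.le
  let w : Fin k → ℝ := fun _ => R
  let u : Fin k → ℝ := Function.update w i t
  have hui : u i = t := by simp [u]
  have huj : ∀ j, j ≠ i → u j = w j := fun j hj => by simp [u, hj]
  have huw : u ≤ w := by
    intro j
    by_cases hj : j = i
    · subst hj; rw [hui]; exact hRt
    · rw [huj j hj]
  have hw := h w (cont_of_good G w fun _ => hR)
  have hu := h u (cont_of_good G u fun j => by
    by_cases hj : j = i
    · subst hj; rw [hui]; exact ht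
    · rw [huj j hj]; exact hR)
  have k1 := marg_le G i u w huj
  have k2 := le_marg G i u
  rw [hui] at k1 k2
  have hq : (1 - ε/4) < mdistrib G w := hRG
  obtain ⟨n1, e1⟩ := Metric.tendsto_atTop'.1 hw (ε/4) (by linarith)
  obtain ⟨n2, e2⟩ := Metric.tendsto_atTop'.1 hu (ε/4) (by linarith)
  refine ⟨max n1 n2, fun n hn => ?_⟩
  have e1 := e1 n (lt_of_le_of_lt (le_max_left _ _) hn)
  have e2 := e2 n (lt_of_le_of_lt (le_max_right _ _) hn)
  rw [Real.dist_eq, abs_lt] at e1 e2 ⊢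
  let u' : Fin k → ℝ := fun j => α n j * u j + β n j
  let w' : Fin k → ℝ := fun j => α n j * w j + β n j
  have huw' : u' ≤ w' := fun j => by
    have := mul_le_mul_of_nonneg_left (huw j) (hα n j).le
    simp only [u', w']; linarith
  have huj' : ∀ j, j ≠ i → u' j = w' j := fun j hj => by simp only [u', w', huj j hj]
  have hui' : u' i = α n i * t + β n i := by simp only [u', hui]
  have m1 := marg_le μ i u' w' huj'
  have m2 := le_marg μ i u'
  rw [hui'] at m1 m2
  have m3 := pow_aux (mdistrib_nonneg μ u') m2 (marg_le_one μ i _) (mdistrib_mono μ huw')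
    (mdistrib_le_one μ w') m1 n
  have m4 := pow_le_pow_left₀ (mdistrib_nonneg μ u') m2 n
  change _ < mdistrib μ w' ^ n - _ ∧ mdistrib μ w' ^ n - _ < _ at e1
  change _ < mdistrib μ u' ^ n - _ ∧ mdistrib μ u' ^ n - _ < _ at e2
  constructor <;> linarith [e1.1, e1.2, e2.1, e2.2]

lemma marg_eq_cdf {k : ℕ} (G : ProbabilityMeasure (Fin k → ℝ)) (i : Fin k) (t : ℝ) :
    margCdf G i t = ProbabilityTheory.cdf ((G : Measure (Fin k → ℝ)).map (fun y => y i)) t := by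
  have : IsProbabilityMeasure ((G : Measure (Fin k → ℝ)).map (fun y => y i)) :=
    Measure.isProbabilityMeasure_map (measurable_pi_apply i).aemeasurable
  rw [ProbabilityTheory.cdf_eq_real, map_measureReal_apply (measurable_pi_apply i) measurableSet_Iic]
  rfl

lemma nondeg_aux {k : ℕ} (G : ProbabilityMeasure (Fin k → ℝ)) (i : Fin k)
    (hG : ∀ c : ℝ, (G : Measure (Fin k → ℝ)).map (fun y => y i) ≠ Measure.dirac c) :
    ∃ t, 0 < margCdf G i t ∧ margCdf G i t < 1 := by
  by_contra! hcon
  have : IsProbabilityMeasure ((G : Measure (Fin k → ℝ)).map (fun y => y i)) :=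
    Measure.isProbabilityMeasure_map (measurable_pi_apply i).aemeasurable
  simp only [marg_eq_cdf] at hcon
  set ρ := (G : Measure (Fin k → ℝ)).map (fun y => y i) with hρ
  let S : Set ℝ := {t | 0 < ProbabilityTheory.cdf ρ t}
  have hmono := ProbabilityTheory.monotone_cdf ρ
  obtain ⟨t1, ht1⟩ := ((ProbabilityTheory.tendsto_cdf_atTop ρ).eventually
    (lt_mem_nhds (zero_lt_one))).exists
  obtain ⟨t0, ht0⟩ := ((ProbabilityTheory.tendsto_cdf_atBot ρ).eventually
    (gt_mem_nhds (zero_lt_one))).exists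
  have hSb : BddBelow S := ⟨t0, fun t ht => by
    by_contra! hlt
    exact absurd (hcon t ht) (not_le.2 ((hmono hlt.le).trans_lt ht0))⟩
  have hSn : S.Nonempty := ⟨t1, ht1⟩
  apply hG (sInf S)
  apply Measure.eq_of_cdf
  ext t
  rw [ProbabilityTheory.cdf_eq_real (Measure.dirac (sInf S)),
    measureReal_def, Measure.dirac_apply' _ measurableSet_Iic]
  have hgt : ∀ t, sInf S < t → ProbabilityTheory.cdf ρ t = 1 := by
    intro t ht
    obtain ⟨s, hs, hst⟩ := exists_lt_of_csInf_lt hSn ht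
    exact le_antisymm (ProbabilityTheory.cdf_le_one ρ t) ((hcon s hs).trans (hmono hst.le))
  by_cases hc : sInf S ≤ t
  · simp only [Set.mem_Iic, hc, Set.indicator_of_mem, Pi.one_apply, ENNReal.toReal_one]
    have hr := (ProbabilityTheory.cdf ρ).right_continuous t
    have hr' : Tendsto (ProbabilityTheory.cdf ρ) (𝓝[>] t) (𝓝 (ProbabilityTheory.cdf ρ t)) :=
      hr.tendsto.mono_left (nhdsWithin_mono _ Set.Ioi_subset_Ici_self)
    refine tendsto_nhds_unique hr' (tendsto_const_nhds.congr' ?_)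
    filter_upwards [self_mem_nhdsWithin] with y hy
    exact (hgt y (lt_of_le_of_lt hc hy)).symm
  · have : t ∉ S := fun h => hc (csInf_le hSb h)
    have h0 : ProbabilityTheory.cdf ρ t = 0 :=
      le_antisymm (not_lt.1 this) (ProbabilityTheory.cdf_nonneg ρ t)
    simp [h0, hc]

lemma marg_mono {k : ℕ} (G : ProbabilityMeasure (Fin k → ℝ)) (i : Fin k) :
    Monotone (margCdf G i) := by
  intro a b h
  rw [marg_eq_cdf, marg_eq_cdf]
  exact ProbabilityTheory.monotone_cdf _ h

lemma points_aux {k : ℕ} (G : ProbabilityMeasure (Fin k → ℝ)) (i : Fin k)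
    (hG : ∀ c : ℝ, (G : Measure (Fin k → ℝ)).map (fun y => y i) ≠ Measure.dirac c) :
    ∃ t t', t < t' ∧ t ∉ badSet G ∧ t' ∉ badSet G ∧ 0 < margCdf G i t ∧ margCdf G i t' < 1 := by
  obtain ⟨a, ha0, ha1⟩ := nondeg_aux G i hG
  have hr := (ProbabilityTheory.cdf ((G : Measure (Fin k → ℝ)).map (fun y => y i))).right_continuous a
  have hr' : Tendsto (margCdf G i) (𝓝[>] a) (𝓝 (margCdf G i a)) := by
    have : margCdf G i = ProbabilityTheory.cdf ((G : Measure (Fin k → ℝ)).map (fun y => y i)) := by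
      funext t; exact marg_eq_cdf G i t
    rw [this]
    exact hr.tendsto.mono_left (nhdsWithin_mono _ Set.Ioi_subset_Ici_self)
  obtain ⟨b, hb1, hab⟩ := ((hr'.eventually (gt_mem_nhds ha1)).and self_mem_nhdsWithin).exists
  obtain ⟨t, ht1, ht2, ht⟩ := exists_good G hab
  obtain ⟨t', ht1', ht2', ht'⟩ := exists_good G ht2
  exact ⟨t, t', ht1', ht, ht', ha0.trans_le (marg_mono G i ht1.le),
    (marg_mono G i ht2'.le).trans_lt hb1⟩

lemma bot_aux {k : ℕ} (G : ProbabilityMeasure (Fin k → ℝ)) (i : Fin k) (η : ℝ) (hη : 0 < η) :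
    ∃ y, y ∉ badSet G ∧ margCdf G i y < η := by
  have : IsProbabilityMeasure ((G : Measure (Fin k → ℝ)).map (fun y => y i)) :=
    Measure.isProbabilityMeasure_map (measurable_pi_apply i).aemeasurable
  obtain ⟨t0, ht0⟩ := ((ProbabilityTheory.tendsto_cdf_atBot
    ((G : Measure (Fin k → ℝ)).map (fun y => y i))).eventually (gt_mem_nhds hη)).exists
  obtain ⟨y, -, hy, hy'⟩ := exists_good G (sub_one_lt t0)
  exact ⟨y, hy', (marg_mono G i hy.le).trans_lt (by rw [marg_eq_cdf]; exact ht0)⟩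

/-- The open dense sets. -/
def goodSet {k : ℕ} (i : Fin k) (N : ℕ) : Set (ProbabilityMeasure (Fin k → ℝ)) :=
  {μ | ∃ s δ p : ℝ, 0 < δ ∧ 0 < p ∧ p < 1 / (N + 1) ∧
    p < (μ : Measure (Fin k → ℝ)).real {ω | s < ω i} ∧
    (μ : Measure (Fin k → ℝ)).real {ω | s + δ ≤ ω i} < p / (N + 1) ∧
    (μ : Measure (Fin k → ℝ)).real {ω | s - (N + 1) * δ ≤ ω i} < 2 * p}

lemma marg_eq_tail {k : ℕ} (μ : ProbabilityMeasure (Fin k → ℝ)) (i : Fin k) (t : ℝ) :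
    margCdf μ i t = 1 - (μ : Measure (Fin k → ℝ)).real {ω | t < ω i} := by
  have h := probReal_compl_eq_one_sub (μ := (μ : Measure (Fin k → ℝ))) (meas_le i t)
  have e : {ω : Fin k → ℝ | ω i ≤ t}ᶜ = {ω | t < ω i} := by
    ext ω; simp
  rw [e] at h
  rw [h, margCdf]; ring

lemma exp_le_aux {x : ℝ} (h0 : 0 ≤ x) (h : x ≤ 1/2) : Real.exp (-(2*x)) ≤ 1 - x := by
  rw [Real.exp_neg]
  have h1 : 2 * x + 1 ≤ Real.exp (2 * x) := Real.add_one_le_exp _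
  have h2 : (Real.exp (2*x))⁻¹ ≤ (2 * x + 1)⁻¹ := inv_anti₀ (by linarith) h1
  refine h2.trans ?_
  rw [inv_le_iff_one_le_mul₀ (by linarith)]
  nlinarith

lemma not_mem_aux {k : ℕ} (μ : ProbabilityMeasure (Fin k → ℝ)) (i : Fin k)
    (hgood : ∀ N, μ ∈ goodSet i N) : ¬ MemMultiDomAttr μ := by
  rintro ⟨α, β, hα, G, hG, h⟩
  obtain ⟨t, t', htt, ht, ht', hg, hg'⟩ := points_aux G i (hG i)
  obtain ⟨A, hA0, hA⟩ : ∃ A : ℝ, 0 < A ∧ Real.exp (-A) < margCdf G i t := by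
    have h1 : Tendsto (fun A : ℝ => Real.exp (-A)) atTop (𝓝 0) :=
      Real.tendsto_exp_neg_atTop_nhds_zero
    exact ((eventually_gt_atTop 0).and (h1.eventually (gt_mem_nhds hg))).exists
  obtain ⟨c, hc, hc1⟩ := exists_between hg'
  obtain ⟨y, hy, hgy⟩ := bot_aux G i (Real.exp (-(4 * (A + 1)))) (Real.exp_pos _)
  have T1 := (marg_tendsto μ G α β hα h i t ht).eventually (lt_mem_nhds hA)
  have T2 := (marg_tendsto μ G α β hα h i t' ht').eventually (gt_mem_nhds hc)
  have T3 := (marg_tendsto μ G α β hα h i y hy).eventually (gt_mem_nhds hgy)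
  obtain ⟨n0, hn0⟩ := eventually_atTop.1 (T1.and (T2.and T3))
  obtain ⟨N, hN⟩ := exists_nat_gt ((A + 1) / (1 - c) + 4 + n0 / A + |t - y| / (t' - t))
  have hc' : 0 < 1 - c := by linarith
  have htt' : 0 < t' - t := by linarith
  have q1 : 0 ≤ (A + 1) / (1 - c) := by positivity
  have q2 : 0 ≤ n0 / A := by positivity
  have q3 : 0 ≤ |t - y| / (t' - t) := by positivity
  have N1 : A + 1 < (N + 1) * (1 - c) := by
    rw [← div_lt_iff₀ hc']; linarith
  have N2 : (4 : ℝ) < N + 1 := by linarith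
  have N3 : (n0 : ℝ) < (N + 1) * A := by
    rw [← div_lt_iff₀ hA0]; linarith
  have N4 : |t - y| < (N + 1) * (t' - t) := by
    rw [← div_lt_iff₀ htt']; linarith
  obtain ⟨s, δ, p, hδ, hp, hpN, h1, h2, h3⟩ := hgood N
  have hNpos : (0 : ℝ) < N + 1 := by linarith
  have hpN' : p * (N + 1) < 1 := by rwa [lt_div_iff₀ hNpos] at hpN
  have hp4 : p < 1 / 4 := by nlinarith
  let n : ℕ := ⌈A / p⌉₊
  have n1 : A ≤ n * p := by
    rw [← div_le_iff₀ hp]; exact Nat.le_ceil _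
  have n2 : n * p ≤ A + 1 := by
    have : (n : ℝ) < A / p + 1 := Nat.ceil_lt_add_one (by positivity)
    have h5 := mul_lt_mul_of_pos_right this hp
    have : (A / p + 1) * p = A + p := by field_simp
    linarith
  have n3 : n0 ≤ n := by
    have : (n0 : ℝ) ≤ n := by
      have : (N + 1) * A ≤ n := by
        have hn : (0 : ℝ) ≤ n := Nat.cast_nonneg n
        calc (N + 1) * A ≤ (N + 1) * (n * p) := mul_le_mul_of_nonneg_left n1 hNpos.le
          _ = n * (p * (N + 1)) := by ring
          _ ≤ n * 1 := mul_le_mul_of_nonneg_left hpN'.le hn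
          _ = n := by ring
      linarith
    exact_mod_cast this
  obtain ⟨e1, e2, e3⟩ := hn0 n n3
  have hn : (0 : ℝ) ≤ n := Nat.cast_nonneg n
  have mono : ∀ S T : Set (Fin k → ℝ), S ⊆ T →
    (μ : Measure (Fin k → ℝ)).real S ≤ (μ : Measure (Fin k → ℝ)).real T :=
    fun S T h => measureReal_mono h
  -- first point lies to the right of `s`
  have f1 : s ≤ α n i * t + β n i := by
    by_contra! hlt
    have m := mono {ω | s < ω i} {ω | α n i * t + β n i < ω i} (fun ω hω => hlt.trans hω)
    have m2 : margCdf μ i (α n i * t + β n i) ≤ Real.exp (-p) := by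
      rw [marg_eq_tail]
      have := Real.add_one_le_exp (-p)
      linarith
    have m3 := pow_le_pow_left₀ (marg_nonneg μ i _) m2 n
    rw [← Real.exp_nat_mul] at m3
    have m4 : Real.exp (n * -p) ≤ Real.exp (-A) := Real.exp_le_exp.2 (by linarith)
    linarith
  have f2 : α n i * t' + β n i < s + δ := by
    by_contra! hle
    have m := mono {ω | α n i * t' + β n i < ω i} {ω | s + δ ≤ ω i}
      (fun ω hω => hle.trans (le_of_lt hω))
    have m2 : 1 + (-(p / (N + 1))) ≤ margCdf μ i (α n i * t' + β n i) := by
      rw [marg_eq_tail]; linarith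
    have hpn : p / (N + 1) ≤ 1 := by
      rw [div_le_one hNpos]; linarith
    have m3 := pow_le_pow_left₀ (by linarith) m2 n
    have m4 := one_add_mul_le_pow (a := -(p / ((N : ℝ) + 1))) (by linarith) n
    have m5 : n * (p / (N + 1)) ≤ 1 - c := by
      rw [← mul_div_assoc, div_le_iff₀ hNpos]; linarith
    linarith
  have f3 : α n i * y + β n i ≤ s - (N + 1) * δ := by
    by_contra! hlt
    have m := mono {ω | α n i * y + β n i < ω i} {ω | s - (N + 1) * δ ≤ ω i}
      (fun ω hω => (hlt.trans hω).le)
    have m2 : Real.exp (-(2 * (2 * p))) ≤ margCdf μ i (α n i * y + β n i) := by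
      rw [marg_eq_tail]
      have := exp_le_aux (x := 2 * p) (by linarith) (by linarith)
      linarith
    have m3 := pow_le_pow_left₀ (Real.exp_pos _).le m2 n
    rw [← Real.exp_nat_mul] at m3
    have m4 : Real.exp (-(4 * (A + 1))) ≤ Real.exp (n * -(2 * (2 * p))) :=
      Real.exp_le_exp.2 (by linarith)
    linarith
  have a0 := hα n i
  have g1 : α n i * (t' - t) < δ := by linarith
  have g2 : (N + 1) * δ ≤ α n i * (t - y) := by linarith
  have g3 : α n i * (t - y) ≤ α n i * ((N + 1) * (t' - t)) :=
    mul_le_mul_of_nonneg_left ((le_abs_self _).trans N4.le) a0.le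
  have g4 := mul_lt_mul_of_pos_left g1 hNpos
  linarith

lemma isOpen_lt_real {k : ℕ} (S : Set (Fin k → ℝ)) (hS : IsOpen S) (c : ℝ) :
    IsOpen {μ : ProbabilityMeasure (Fin k → ℝ) | c < (μ : Measure (Fin k → ℝ)).real S} := by
  rw [isOpen_iff_mem_nhds]
  intro μ hμ
  rcases lt_or_ge c 0 with hc | hc
  · exact Filter.mem_of_superset univ_mem fun ν _ => hc.trans_le measureReal_nonneg
  have h := ProbabilityMeasure.le_liminf_measure_open_of_tendsto (tendsto_id (x := 𝓝 μ)) hS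
  have hμ' : ENNReal.ofReal c < (μ : Measure (Fin k → ℝ)) S := by
    rw [ENNReal.ofReal_lt_iff_lt_toReal hc (by finiteness)]; exact hμ
  have := eventually_lt_of_lt_liminf (hμ'.trans_le h)
  filter_upwards [this] with ν hν
  simp only [id] at hν
  rw [ENNReal.ofReal_lt_iff_lt_toReal hc (by finiteness)] at hν
  exact hν

lemma isOpen_real_lt {k : ℕ} (S : Set (Fin k → ℝ)) (hS : IsClosed S) (c : ℝ) :
    IsOpen {μ : ProbabilityMeasure (Fin k → ℝ) | (μ : Measure (Fin k → ℝ)).real S < c} := by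
  convert isOpen_lt_real Sᶜ hS.isOpen_compl (1 - c) using 3 with μ
  rw [probReal_compl_eq_one_sub hS.measurableSet]
  constructor <;> intro h <;> linarith

lemma goodSet_open {k : ℕ} (i : Fin k) (N : ℕ) : IsOpen (goodSet i N) := by
  have e : goodSet i N = ⋃ (s : ℝ) (δ : ℝ) (p : ℝ) (_ : 0 < δ) (_ : 0 < p)
      (_ : p < 1 / ((N : ℝ) + 1)),
      {μ : ProbabilityMeasure (Fin k → ℝ) | p < (μ : Measure (Fin k → ℝ)).real {ω | s < ω i}} ∩
      ({μ : ProbabilityMeasure (Fin k → ℝ) |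
        (μ : Measure (Fin k → ℝ)).real {ω | s + δ ≤ ω i} < p / (N + 1)} ∩
      {μ : ProbabilityMeasure (Fin k → ℝ) |
        (μ : Measure (Fin k → ℝ)).real {ω | s - (N + 1) * δ ≤ ω i} < 2 * p}) := by
    ext μ
    simp only [Set.mem_iUnion, Set.mem_inter_iff]
    constructor
    · rintro ⟨s, δ, p, a, b, c, d, e, f⟩
      exact ⟨s, δ, p, a, b, c, d, e, f⟩
    · rintro ⟨s, δ, p, a, b, c, d, e, f⟩
      exact ⟨s, δ, p, a, b, c, d, e, f⟩
  rw [e]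
  refine isOpen_iUnion fun s => isOpen_iUnion fun δ => isOpen_iUnion fun p =>
    isOpen_iUnion fun _ => isOpen_iUnion fun _ => isOpen_iUnion fun _ => ?_
  exact (isOpen_lt_real _ (isOpen_lt continuous_const (continuous_apply i)) _).inter
    ((isOpen_real_lt _ (isClosed_le continuous_const (continuous_apply i)) _).inter
    (isOpen_real_lt _ (isClosed_le continuous_const (continuous_apply i)) _))

/-- The mixture `(1-ε) μ + ε δ_z`. -/
noncomputable def mixMeas {k : ℕ} (μ : ProbabilityMeasure (Fin k → ℝ)) (ε : ℝ) (z : Fin k → ℝ) :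
    Measure (Fin k → ℝ) :=
  ENNReal.ofReal (1 - ε) • (μ : Measure (Fin k → ℝ)) + ENNReal.ofReal ε • Measure.dirac z

lemma mix_prob {k : ℕ} (μ : ProbabilityMeasure (Fin k → ℝ)) (ε : ℝ) (h0 : 0 ≤ ε) (h1 : ε ≤ 1)
    (z : Fin k → ℝ) : IsProbabilityMeasure (mixMeas μ ε z) := by
  constructor
  simp only [mixMeas, Measure.add_apply, Measure.smul_apply, measure_univ, smul_eq_mul, mul_one]
  rw [← ENNReal.ofReal_add (by linarith) h0]
  simp

lemma mix_real {k : ℕ} (μ : ProbabilityMeasure (Fin k → ℝ)) (ε : ℝ) (h0 : 0 ≤ ε) (h1 : ε ≤ 1)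
    (z : Fin k → ℝ) (S : Set (Fin k → ℝ)) :
    (mixMeas μ ε z).real S =
      (1 - ε) * (μ : Measure (Fin k → ℝ)).real S + ε * (Measure.dirac z).real S := by
  have e1 : (ENNReal.ofReal (1 - ε) • (μ : Measure (Fin k → ℝ))) S ≠ ⊤ := by
    rw [Measure.smul_apply, smul_eq_mul]; finiteness
  have e2 : (ENNReal.ofReal ε • Measure.dirac z) S ≠ ⊤ := by
    rw [Measure.smul_apply, smul_eq_mul]; finiteness
  rw [mixMeas, measureReal_add_apply e1 e2, measureReal_ennreal_smul_apply,
    measureReal_ennreal_smul_apply, ENNReal.toReal_ofReal (by linarith), ENNReal.toReal_ofReal h0]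

lemma tail_aux {k : ℕ} (μ : ProbabilityMeasure (Fin k → ℝ)) (i : Fin k) (η : ℝ) (hη : 0 < η) :
    ∃ z : ℝ, (μ : Measure (Fin k → ℝ)).real {ω | z ≤ ω i} < η := by
  obtain ⟨R, hR⟩ := top_aux μ η hη
  refine ⟨R + 1, ?_⟩
  have h1 := hR R le_rfl
  have h2 := le_marg μ i (fun _ => R)
  rw [marg_eq_tail] at h2
  have h3 : (μ : Measure (Fin k → ℝ)).real {ω | R + 1 ≤ ω i} ≤
      (μ : Measure (Fin k → ℝ)).real {ω | R < ω i} :=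
    measureReal_mono (fun ω (hω : R + 1 ≤ ω i) => lt_of_lt_of_le (lt_add_one R) hω)
  linarith

lemma mix_good {k : ℕ} (μ : ProbabilityMeasure (Fin k → ℝ)) (i : Fin k) (N : ℕ) (ε : ℝ)
    (h0 : 0 < ε) (h1 : ε < 1 / (N + 1)) :
    ∃ z : Fin k → ℝ, ∃ ν : ProbabilityMeasure (Fin k → ℝ), ν ∈ goodSet i N ∧
      (ν : Measure (Fin k → ℝ)) = mixMeas μ ε z := by
  have hN : (0 : ℝ) ≤ N := Nat.cast_nonneg N
  have hNpos : (0 : ℝ) < N + 1 := by linarith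
  have h1' : ε < 1 := h1.trans_le (by rw [div_le_one hNpos]; linarith)
  obtain ⟨a, ha⟩ := tail_aux μ i (ε / (4 * (N + 1))) (by positivity)
  let b : ℝ := a + (N + 1) + 1 / 2
  let z : Fin k → ℝ := fun _ => b
  refine ⟨z, ⟨mixMeas μ ε z, mix_prob μ ε h0.le h1'.le z⟩, ?_, rfl⟩
  have mono : ∀ S, S ⊆ {ω : Fin k → ℝ | a ≤ ω i} →
    (μ : Measure (Fin k → ℝ)).real S < ε / (4 * (N + 1)) :=
    fun S h => (measureReal_mono h).trans_lt ha
  have hsm : ε / (4 * (N + 1)) ≤ ε / 4 := by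
    apply div_le_div_of_nonneg_left h0.le (by norm_num); linarith
  have hle : ∀ S, (1 - ε) * (μ : Measure (Fin k → ℝ)).real S ≤ (μ : Measure (Fin k → ℝ)).real S :=
    fun S => mul_le_of_le_one_left measureReal_nonneg (by linarith)
  refine ⟨b - 1/2, 1, 3 / 4 * ε, one_pos, by positivity, by linarith, ?_, ?_, ?_⟩
  · change _ < (mixMeas μ ε z).real _
    rw [mix_real μ ε h0.le h1'.le]
    have hd : (Measure.dirac z).real {ω : Fin k → ℝ | b - 1/2 < ω i} = 1 := by
      rw [measureReal_def, Measure.dirac_apply_of_mem (by simp [z])]; simp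
    rw [hd]
    have : 0 ≤ (1 - ε) * (μ : Measure (Fin k → ℝ)).real {ω : Fin k → ℝ | b - 1/2 < ω i} :=
      mul_nonneg (by linarith) measureReal_nonneg
    linarith
  · change (mixMeas μ ε z).real _ < _
    rw [mix_real μ ε h0.le h1'.le]
    have hd : (Measure.dirac z).real {ω : Fin k → ℝ | b - 1/2 + 1 ≤ ω i} = 0 := by
      rw [measureReal_def, Measure.dirac_apply' _
        (measurableSet_le measurable_const (measurable_pi_apply i)), Set.indicator_of_notMem]
      · simp
      · simp only [Set.mem_ofPred_eq, z]; linarith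
    rw [hd]
    have m := mono {ω : Fin k → ℝ | b - 1/2 + 1 ≤ ω i} (fun ω hω => by
      simp only [Set.mem_ofPred_eq, b] at hω ⊢; linarith)
    have m2 := hle {ω : Fin k → ℝ | b - 1/2 + 1 ≤ ω i}
    have m3 : ε / (4 * (N + 1)) ≤ 3 / 4 * ε / (N + 1) := by
      rw [div_le_div_iff₀ (by positivity) hNpos]; nlinarith [mul_pos h0 hNpos]
    linarith
  · change (mixMeas μ ε z).real _ < _
    rw [mix_real μ ε h0.le h1'.le]
    have hd : (Measure.dirac z).real {ω : Fin k → ℝ | b - 1/2 - (N + 1) * 1 ≤ ω i} ≤ 1 :=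
      measureReal_le_one
    have m := mono {ω : Fin k → ℝ | b - 1/2 - (N + 1) * 1 ≤ ω i} (fun ω hω => by
      simp only [Set.mem_ofPred_eq, b] at hω ⊢; linarith)
    have m2 := hle {ω : Fin k → ℝ | b - 1/2 - (N + 1) * 1 ≤ ω i}
    have m3 := mul_le_mul_of_nonneg_left hd h0.le
    linarith

lemma goodSet_dense {k : ℕ} (i : Fin k) (N : ℕ) : Dense (goodSet i N) := by
  intro μ
  have hNpos : (0 : ℝ) < N + 1 := by positivity
  let ε : ℕ → ℝ := fun j => 1 / (N + 1) / (j + 2)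
  have hε0 : ∀ j, 0 < ε j := fun j => by positivity
  have hε1 : ∀ j, ε j < 1 / (N + 1) := fun j => by
    apply div_lt_self (by positivity)
    have : (0 : ℝ) ≤ j := Nat.cast_nonneg j
    linarith
  have hε1' : ∀ j, ε j ≤ 1 := fun j => (hε1 j).le.trans (by
    rw [div_le_one hNpos]; linarith [(Nat.cast_nonneg N : (0 : ℝ) ≤ N)])
  have hεt : Tendsto ε atTop (𝓝 0) := by
    apply Tendsto.div_atTop tendsto_const_nhds
    exact tendsto_atTop_add_const_right _ _ tendsto_natCast_atTop_atTop
  choose z ν hν hmix using fun j => mix_good μ i N (ε j) (hε0 j) (hε1 j)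
  refine mem_closure_of_tendsto (f := ν) (b := atTop) ?_ (Eventually.of_forall hν)
  rw [ProbabilityMeasure.tendsto_iff_forall_integral_tendsto]
  intro f
  have e : ∀ j, ∫ ω, f ω ∂(ν j : Measure (Fin k → ℝ)) =
      (1 - ε j) * ∫ ω, f ω ∂(μ : Measure (Fin k → ℝ)) + ε j * f (z j) := by
    intro j
    rw [hmix, mixMeas, integral_add_measure, integral_smul_measure, integral_smul_measure,
      integral_dirac, ENNReal.toReal_ofReal (by linarith [hε1' j]),
      ENNReal.toReal_ofReal (hε0 j).le, smul_eq_mul, smul_eq_mul]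
    · exact (f.integrable _).smul_measure (by finiteness)
    · exact (f.integrable _).smul_measure (by finiteness)
  simp only [e]
  have l1 : Tendsto (fun j => (1 - ε j) * ∫ ω, f ω ∂(μ : Measure (Fin k → ℝ))) atTop
      (𝓝 ((1 - 0) * ∫ ω, f ω ∂(μ : Measure (Fin k → ℝ)))) :=
    (tendsto_const_nhds.sub hεt).mul_const _
  have l2 : Tendsto (fun j => ε j * f (z j)) atTop (𝓝 0) := by
    refine squeeze_zero_norm (a := fun j => ε j * ‖f‖) (fun j => ?_) ?_
    · rw [norm_mul, Real.norm_of_nonneg (hε0 j).le]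
      exact mul_le_mul_of_nonneg_left (f.norm_coe_le_norm _) (hε0 j).le
    · simpa using hεt.mul_const ‖f‖
  simpa using l1.add l2

/-- For every `k ≥ 1`, the set `D` of probability measures on `ℝ^k` belonging to the
multivariate maximum domain of attraction is meagre (of the first Baire category) in the
space of Borel probability measures on `ℝ^k` with the topology of weak convergence. -/
theorem meagre_multivariate_domain_of_attraction (k : ℕ) (hk : 1 ≤ k) :
    IsMeagre {μ : ProbabilityMeasure (Fin k → ℝ) | MemMultiDomAttr μ} := by
  let i : Fin k := ⟨0, hk⟩
  have hres : (⋂ N : ℕ, goodSet i N) ∈ residual (ProbabilityMeasure (Fin k → ℝ)) :=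
    countable_iInter_mem.2 fun N => residual_of_dense_open (goodSet_open i N) (goodSet_dense i N)
  refine Filter.mem_of_superset hres fun μ hμ hD => ?_
  exact not_mem_aux μ i (fun N => Set.mem_iInter.1 hμ N) hD
end

section
/- Let F be the distribution function of a Borel probability measure on R, and suppose F belongs to D(G_gamma) for some gamma > 0. Then the right endpoint x_F is infinite, and the limit as n -> infty of (1 - F(2^(n+1))) / (1 - F(2^n)) exists and belongs to the open interval (0, 1). -/
open MeasureTheory Filter Topology Set NNReal

/-- The cumulative distribution function of a Borel probability measure on `ℝ`:
`F(x) = μ((-∞, x])`. -/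
noncomputable def distrib (μ : ProbabilityMeasure ℝ) (x : ℝ) : ℝ :=
  (μ (Set.Iic x) : ℝ≥0)

/-- The generalized extreme value distribution function `G_γ`, with
`G_γ(x) = exp(-(1+γx)^(-1/γ))` where `1 + γx > 0` (interpreted as
`G_0(x) = exp(-e^(-x))` when `γ = 0`). -/
noncomputable def evCdf (γ : ℝ) (x : ℝ) : ℝ :=
  if γ = 0 then Real.exp (-Real.exp (-x))
  else if 0 < 1 + γ * x then Real.exp (-(1 + γ * x) ^ (-1 / γ))
  else if 0 < γ then 0 else 1

/-- `μ` belongs to the maximum domain of attraction `D(G_γ)`: there are `a n > 0` and `b n`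
such that `(F (a n * x + b n)) ^ n → G_γ x` at every continuity point `x` of `G_γ`. -/
def MemDomAttr (γ : ℝ) (μ : ProbabilityMeasure ℝ) : Prop :=
  ∃ a b : ℕ → ℝ, (∀ n, 0 < a n) ∧
    ∀ x : ℝ, ContinuousAt (evCdf γ) x →
      Tendsto (fun n : ℕ => distrib μ (a n * x + b n) ^ n) atTop (𝓝 (evCdf γ x))

/-- The right endpoint `x_F = sup {x : F x < 1}` of a distribution, as an extended real. -/
noncomputable def rightEndpoint (μ : ProbabilityMeasure ℝ) : EReal :=
  sSup ((fun x : ℝ => (x : EReal)) '' {x : ℝ | distrib μ x < 1})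

theorem aux_mono_conv {ι : Type*} {l : Filter ι} {f : ι → ℝ → ℝ} (hf : ∀ i, Antitone (f i))
    {p : ℝ} (hfl : ∀ z : ℝ, 0 < z → Tendsto (fun i => f i z) l (𝓝 (z ^ p)))
    {w : ι → ℝ} {y : ℝ} (hy : 0 < y) (hw : Tendsto w l (𝓝 y)) :
    Tendsto (fun i => f i (w i)) l (𝓝 (y ^ p)) := by
  have hc : ContinuousAt (fun z : ℝ => z ^ p) y := Real.continuousAt_rpow_const y p (Or.inl hy.ne')
  rw [tendsto_order]
  constructor
  · intro a ha
    have h1 : ∀ᶠ z in 𝓝[>] y, a < z ^ p := (hc.eventually (lt_mem_nhds ha)).filter_mono nhdsWithin_le_nhds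
    obtain ⟨z, hz, hyz⟩ := (h1.and self_mem_nhdsWithin).exists
    have hyz : y < z := hyz
    filter_upwards [(hfl z (hy.trans hyz)).eventually (lt_mem_nhds hz), hw.eventually (gt_mem_nhds hyz)]
      with i h2 h3
    exact h2.trans_le (hf i h3.le)
  · intro a ha
    have h1 : ∀ᶠ z in 𝓝[<] y, z ^ p < a ∧ 0 < z :=
      ((hc.eventually (gt_mem_nhds ha)).and (lt_mem_nhds hy)).filter_mono nhdsWithin_le_nhds
    obtain ⟨z, ⟨hz, hz0⟩, hyz⟩ := (h1.and self_mem_nhdsWithin).exists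
    have hyz : z < y := hyz
    filter_upwards [(hfl z hz0).eventually (gt_mem_nhds hz), hw.eventually (lt_mem_nhds hyz)]
      with i h2 h3
    exact (hf i h3.le).trans_lt h2

theorem aux_mono_inv {ι : Type*} {l : Filter ι} {f : ι → ℝ → ℝ} (hf : ∀ i, Antitone (f i))
    {p : ℝ} (hp : p < 0) (hfl : ∀ z : ℝ, 0 < z → Tendsto (fun i => f i z) l (𝓝 (z ^ p)))
    {w : ι → ℝ} {v : ℝ} (hv : 0 < v) (hw : Tendsto (fun i => f i (w i)) l (𝓝 (v ^ p))) :
    Tendsto w l (𝓝 v) := by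
  rw [tendsto_order]
  constructor
  · intro a ha
    obtain ⟨z, hz1, hzv⟩ := exists_between (max_lt ha hv)
    have hz0 : 0 < z := (le_max_right _ _).trans_lt hz1
    have hlt : v ^ p < z ^ p := Real.rpow_lt_rpow_of_neg hz0 hzv hp
    filter_upwards [(hw.eventually_lt (hfl z hz0) hlt)] with i hi
    by_contra hcon
    push Not at hcon
    exact absurd (hf i (hcon.trans ((le_max_left _ _).trans hz1.le))) (not_le.2 hi)
  · intro a ha
    have hlt : a ^ p < v ^ p := Real.rpow_lt_rpow_of_neg hv ha hp
    filter_upwards [((hfl a (hv.trans ha)).eventually_lt hw hlt)] with i hi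
    by_contra hcon
    push Not at hcon
    exact absurd (hf i hcon) (not_le.2 hi)

theorem aux_rec {r ρ ε : ℕ → ℝ} {q : ℝ} (hq0 : 0 ≤ q) (hq : q < 1) (hρ : Tendsto ρ atTop (𝓝 q))
    (hε : Tendsto ε atTop (𝓝 0)) (hr : ∀ k, r (k + 1) = ρ k * r k + ε k) :
    Tendsto r atTop (𝓝 0) := by
  obtain ⟨s, hqs, hs1⟩ := exists_between hq
  have hs0 : 0 < s := hq0.trans_lt hqs
  have hρ' : ∀ᶠ k in atTop, |ρ k| < s := by
    have := hρ.abs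
    rw [abs_of_nonneg hq0] at this
    exact this.eventually (gt_mem_nhds hqs)
  rw [Metric.tendsto_atTop]
  intro e he
  have hε' : ∀ᶠ k in atTop, |ε k| < (1 - s) * (e / 2) := by
    have := hε.abs
    rw [abs_zero] at this
    exact this.eventually (gt_mem_nhds (mul_pos (by linarith) (by linarith)))
  obtain ⟨K, hK⟩ := eventually_atTop.1 (hρ'.and hε')
  have key : ∀ j, |r (K + j)| ≤ s ^ j * |r K| + e / 2 := by
    intro j
    induction j with
    | zero => simp; linarith
    | succ j ih =>
      obtain ⟨h1, h2⟩ := hK (K + j) (by omega)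
      rw [← add_assoc, hr]
      calc |ρ (K + j) * r (K + j) + ε (K + j)| ≤ |ρ (K + j)| * |r (K + j)| + |ε (K + j)| := by
            rw [← abs_mul]; exact abs_add_le _ _
        _ ≤ s * (s ^ j * |r K| + e / 2) + (1 - s) * (e / 2) := by gcongr
        _ = _ := by ring
  have hp : Tendsto (fun j : ℕ => s ^ j * |r K|) atTop (𝓝 0) := by
    simpa using (tendsto_pow_atTop_nhds_zero_of_lt_one hs0.le hs1).mul_const |r K|
  obtain ⟨J, hJ⟩ := eventually_atTop.1 (hp.eventually (gt_mem_nhds (half_pos he)))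
  refine ⟨K + J, fun n hn => ?_⟩
  obtain ⟨j, rfl⟩ := Nat.exists_eq_add_of_le (show K ≤ n by omega)
  have := hJ j (by omega)
  have := key j
  rw [Real.dist_eq, sub_zero]
  linarith

theorem aux_log {F : ℕ → ℝ} (hF : ∀ n, 0 ≤ F n) {τ : ℝ}
    (h : Tendsto (fun n : ℕ => F n ^ n) atTop (𝓝 (Real.exp (-τ)))) :
    Tendsto (fun n : ℕ => (n : ℝ) * (1 - F n)) atTop (𝓝 τ) := by
  have h1 : Tendsto (fun n : ℕ => (n : ℝ) * Real.log (F n)) atTop (𝓝 (-τ)) := by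
    have := h.log (Real.exp_pos _).ne'
    simpa [Real.log_exp, Real.log_pow] using this
  have h2 : Tendsto (fun n : ℕ => Real.log (F n)) atTop (𝓝 0) := by
    have := h1.mul (tendsto_inv_atTop_nhds_zero_nat (𝕜 := ℝ))
    rw [mul_zero] at this
    refine this.congr' ?_
    filter_upwards [eventually_gt_atTop 0] with n hn
    have : (n : ℝ) ≠ 0 := by exact_mod_cast hn.ne'
    field_simp
  have h3 : ∀ᶠ n in atTop, 0 < F n := by
    filter_upwards [h.eventually (lt_mem_nhds (Real.exp_pos _)), eventually_gt_atTop 0] with n hn hn0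
    rcases (hF n).eq_or_lt with h0 | h0
    · rw [← h0, zero_pow hn0.ne'] at hn
      exact absurd hn (lt_irrefl _)
    · exact h0
  have h4 : Tendsto (fun n : ℕ => -((n : ℝ) * Real.log (F n))) atTop (𝓝 τ) := by
    simpa using h1.neg
  have h5 : Tendsto (fun n : ℕ => -((n : ℝ) * Real.log (F n)) * Real.exp (Real.log (F n)))
      atTop (𝓝 τ) := by
    simpa using h4.mul h2.rexp
  refine tendsto_of_tendsto_of_tendsto_of_le_of_le' h5 h4 ?_ ?_
  · filter_upwards [h3] with n hn
    have e1 := Real.add_one_le_exp (-Real.log (F n))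
    rw [Real.exp_neg, Real.exp_log hn] at e1
    rw [Real.exp_log hn]
    have e2 : (-Real.log (F n) + 1) * F n ≤ 1 := by
      calc _ ≤ (F n)⁻¹ * F n := by gcongr
        _ = 1 := inv_mul_cancel₀ hn.ne'
    have e3 : 0 ≤ (n : ℝ) * (1 - (-Real.log (F n) + 1) * F n) :=
      mul_nonneg (Nat.cast_nonneg n) (by linarith)
    nlinarith
  · filter_upwards [h3] with n hn
    have e1 := Real.log_le_sub_one_of_pos hn
    have e3 : 0 ≤ (n : ℝ) * (F n - 1 - Real.log (F n)) :=
      mul_nonneg (Nat.cast_nonneg n) (by linarith)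
    nlinarith

/-- The analytic core: a nonincreasing tail with dyadic convergence. -/
theorem aux_core {S : ℝ → ℝ} (hS : Antitone S) {p : ℝ} (hp : p < 0) {A B : ℕ → ℝ}
    (hA : ∀ k, 0 < A k)
    (h : ∀ y : ℝ, 0 < y → Tendsto (fun k : ℕ => (2 : ℝ) ^ k * S (A k * y + B k)) atTop (𝓝 (y ^ p))) :
    (∀ t, 0 < S t) ∧
      Tendsto (fun n : ℕ => S (2 ^ (n + 1)) / S (2 ^ n)) atTop (𝓝 ((2 : ℝ) ^ p)) := by
  set f : ℕ → ℝ → ℝ := fun k y => (2 : ℝ) ^ k * S (A k * y + B k) with hfdef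
  have hf : ∀ k, Antitone (f k) := by
    intro k x y hxy
    have : A k * x + B k ≤ A k * y + B k := by
      have := mul_le_mul_of_nonneg_left hxy (hA k).le
      linarith
    exact mul_le_mul_of_nonneg_left (hS this) (by positivity)
  set c : ℝ := (2 : ℝ) ^ (-1 / p) with hc
  have hc1 : 1 < c := Real.one_lt_rpow one_lt_two (div_pos_of_neg_of_neg (by norm_num) hp)
  have hc0 : 0 < c := by linarith
  have hcp : c ^ p = 2⁻¹ := by
    rw [hc, ← Real.rpow_mul (by norm_num), div_mul_cancel₀ _ hp.ne, Real.rpow_neg_one]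
  -- convergence of types
  have hty : ∀ y : ℝ, 0 < y →
      Tendsto (fun k => (A (k + 1) * y + B (k + 1) - B k) / A k) atTop (𝓝 (c * y)) := by
    intro y hy
    refine aux_mono_inv hf hp h (mul_pos hc0 hy) ?_
    rw [Real.mul_rpow hc0.le hy.le, hcp]
    have := ((h y hy).comp (tendsto_add_atTop_nat 1)).const_mul (2⁻¹ : ℝ)
    refine this.congr fun k => ?_
    have e : A k * ((A (k + 1) * y + B (k + 1) - B k) / A k) + B k = A (k + 1) * y + B (k + 1) := by
      rw [mul_div_cancel₀ _ (hA k).ne']; ring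
    simp only [hfdef, Function.comp, e, pow_succ]
    ring
  have hAr : Tendsto (fun k => A (k + 1) / A k) atTop (𝓝 c) := by
    have := (hty 2 two_pos).sub (hty 1 one_pos)
    rw [show c * 2 - c * 1 = c by ring] at this
    refine this.congr fun k => ?_
    rw [← _root_.sub_div]; congr 1; ring
  have hBr : Tendsto (fun k => (B (k + 1) - B k) / A k) atTop (𝓝 0) := by
    have := (hty 1 one_pos).sub hAr
    rw [show c * 1 - c = 0 by ring] at this
    refine this.congr fun k => ?_
    rw [← _root_.sub_div]; congr 1; ring
  have hAi : Tendsto (fun k => A k / A (k + 1)) atTop (𝓝 c⁻¹) :=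
    (hAr.inv₀ hc0.ne').congr fun k => by rw [inv_div]
  have hci : c⁻¹ < 1 := inv_lt_one_of_one_lt₀ hc1
  have hAinv : Tendsto (fun k => (A k)⁻¹) atTop (𝓝 0) := by
    refine aux_rec (inv_nonneg.2 hc0.le) hci hAi (tendsto_const_nhds (x := (0 : ℝ))) fun k => ?_
    have := (hA k).ne'
    have := (hA (k + 1)).ne'
    field_simp
    simp
  have hBA : Tendsto (fun k => B k / A k) atTop (𝓝 0) := by
    have he : Tendsto (fun k => (B (k + 1) - B k) / A k * (A k / A (k + 1))) atTop (𝓝 0) := by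
      simpa using hBr.mul hAi
    refine aux_rec (inv_nonneg.2 hc0.le) hci hAi he fun k => ?_
    have := (hA k).ne'
    have := (hA (k + 1)).ne'
    field_simp
    ring
  have hAtop : Tendsto A atTop atTop := by
    have : Tendsto (fun k => (A k)⁻¹) atTop (𝓝[>] 0) :=
      tendsto_nhdsWithin_iff.2 ⟨hAinv, Eventually.of_forall fun k => inv_pos.2 (hA k)⟩
    exact this.inv_tendsto_nhdsGT_zero.congr fun k => inv_inv (A k)
  -- key convergence
  have key : ∀ (m : ℕ → ℕ) (w : ℕ → ℝ) (y : ℝ), 0 < y → Tendsto m atTop atTop →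
      Tendsto w atTop (𝓝 y) →
      Tendsto (fun n => (2 : ℝ) ^ m n * S (A (m n) * w n)) atTop (𝓝 (y ^ p)) := by
    intro m w y hy hm hw
    have h1 : Tendsto (fun n => w n - B (m n) / A (m n)) atTop (𝓝 y) := by
      simpa using hw.sub (hBA.comp hm)
    have := aux_mono_conv (f := fun n => f (m n)) (fun n => hf (m n))
      (fun z hz => (h z hz).comp hm) hy h1
    refine this.congr fun n => ?_
    simp only [hfdef]
    congr 2
    have := (hA (m n)).ne'
    field_simp
    ring
  have hpos : ∀ t, 0 < S t := by
    intro t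
    have h1 := key id (fun _ => 1) 1 one_pos tendsto_id tendsto_const_nhds
    rw [Real.one_rpow] at h1
    obtain ⟨k, hk, hkt⟩ := ((h1.eventually (lt_mem_nhds one_pos)).and
      (hAtop.eventually_ge_atTop t)).exists
    have h2 : 0 < S (A k * 1) := pos_of_mul_pos_right hk (by positivity)
    rw [mul_one] at h2
    exact h2.trans_le (hS hkt)
  refine ⟨hpos, ?_⟩
  have hex : ∀ n : ℕ, ∃ m, (2 : ℝ) ^ n < A m := fun n =>
    (hAtop.eventually_gt_atTop _).exists
  classical
  set m : ℕ → ℕ := fun n => Nat.find (hex n) with hm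
  have hm1 : ∀ n, (2 : ℝ) ^ n < A (m n) := fun n => Nat.find_spec (hex n)
  have hm2 : ∀ n j, j < m n → A j ≤ (2 : ℝ) ^ n := fun n j hj => not_lt.1 (Nat.find_min (hex n) hj)
  have h2top : Tendsto (fun n : ℕ => (2 : ℝ) ^ n) atTop atTop :=
    tendsto_pow_atTop_atTop_of_one_lt one_lt_two
  have hmtop : Tendsto m atTop atTop := by
    rw [tendsto_atTop]
    intro K
    have : ∀ᶠ n : ℕ in atTop, ∀ j ∈ Finset.range K, A j ≤ (2 : ℝ) ^ n := by
      rw [Filter.eventually_all_finset]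
      intro j _
      exact h2top.eventually_ge_atTop _
    filter_upwards [this] with n hn
    by_contra hcon
    push Not at hcon
    exact absurd (hm1 n) (not_lt.2 (hn _ (Finset.mem_range.2 hcon)))
  set d : ℝ := c⁻¹ / 2 with hd
  have hd0 : 0 < d := by positivity
  have hw : ∀ᶠ n in atTop, (2 : ℝ) ^ n / A (m n) ∈ Set.Icc d 1 := by
    have h1 : ∀ᶠ k in atTop, d < A k / A (k + 1) :=
      hAi.eventually (lt_mem_nhds (half_lt_self (inv_pos.2 hc0)))
    obtain ⟨K, hK⟩ := eventually_atTop.1 h1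
    filter_upwards [hmtop.eventually_ge_atTop (K + 1)] with n hn
    refine ⟨?_, (div_le_one (hA _)).2 (hm1 n).le⟩
    obtain ⟨j, hj⟩ : ∃ j, m n = j + 1 := ⟨m n - 1, by omega⟩
    rw [hj]
    refine (hK j (by omega)).le.trans ?_
    exact div_le_div_of_nonneg_right (hm2 n j (by omega)) (hA _).le
  refine tendsto_of_subseq_tendsto fun ns hns => ?_
  have hwn := hns.eventually hw
  obtain ⟨y, hy, φ, hφ, hlim⟩ := (isCompact_Icc (a := d) (b := 1)).tendsto_subseq'
    (x := fun n => (2 : ℝ) ^ (ns n) / A (m (ns n))) hwn.frequently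
  refine ⟨φ, ?_⟩
  have hy0 : 0 < y := hd0.trans_le hy.1
  have hmm : Tendsto (fun n => m (ns (φ n))) atTop atTop :=
    hmtop.comp (hns.comp hφ.tendsto_atTop)
  have k1 := key _ _ y hy0 hmm hlim
  have k2 := key _ _ (2 * y) (by positivity) hmm (hlim.const_mul 2)
  have k3 := k2.div k1 (Real.rpow_pos_of_pos hy0 p).ne'
  rw [Real.mul_rpow two_pos.le hy0.le, mul_div_cancel_right₀ _ (Real.rpow_pos_of_pos hy0 p).ne'] at k3
  refine k3.congr fun n => ?_
  have hAn := (hA (m (ns (φ n)))).ne'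
  have e1 : A (m (ns (φ n))) * (2 * ((2 : ℝ) ^ ns (φ n) / A (m (ns (φ n))))) = 2 ^ (ns (φ n) + 1) := by
    field_simp
    ring
  have e2 : A (m (ns (φ n))) * ((2 : ℝ) ^ ns (φ n) / A (m (ns (φ n)))) = 2 ^ (ns (φ n)) := by
    field_simp
  simp only [Pi.div_apply, Function.comp, e1, e2]
  rw [mul_div_mul_left _ _ (by positivity)]

/-- If `F ∈ D(G_γ)` for some `γ > 0`, then the right endpoint `x_F` is infinite and the
limit of `(1 - F(2^(n+1))) / (1 - F(2^n))` as `n → ∞` exists and lies in `(0, 1)`. -/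
theorem frechet_domain_necessary (μ : ProbabilityMeasure ℝ) (γ : ℝ) (hγ : 0 < γ)
    (h : MemDomAttr γ μ) :
    rightEndpoint μ = ⊤ ∧
      ∃ L ∈ Set.Ioo (0 : ℝ) 1,
        Tendsto (fun n : ℕ => (1 - distrib μ (2 ^ (n + 1))) / (1 - distrib μ (2 ^ n)))
          atTop (𝓝 L) := by
  obtain ⟨a, b, ha, hab⟩ := h
  have hmono : Monotone (distrib μ) := by
    intro x y hxy
    simp only [distrib]
    exact_mod_cast ProbabilityMeasure.apply_mono μ (Set.Iic_subset_Iic.2 hxy)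
  have hnn : ∀ x, 0 ≤ distrib μ x := fun x => NNReal.coe_nonneg _
  have hS : Antitone (fun x => 1 - distrib μ x) := fun x y hxy => by
    have := hmono hxy
    show 1 - distrib μ y ≤ 1 - distrib μ x
    linarith
  have hp : -1 / γ < 0 := div_neg_of_neg_of_pos (by norm_num) hγ
  have hG : ∀ y : ℝ, 0 < y → evCdf γ ((y - 1) / γ) = Real.exp (-y ^ (-1 / γ)) := by
    intro y hy
    have e : 1 + γ * ((y - 1) / γ) = y := by field_simp; ring
    rw [evCdf, if_neg hγ.ne', e, if_pos hy]
  have hcont : ∀ y : ℝ, 0 < y → ContinuousAt (evCdf γ) ((y - 1) / γ) := by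
    intro y hy
    have e : 1 + γ * ((y - 1) / γ) = y := by field_simp; ring
    have h1 : ContinuousAt (fun x : ℝ => 1 + γ * x) ((y - 1) / γ) := by fun_prop
    have h2 : ContinuousAt (fun x : ℝ => Real.exp (-(1 + γ * x) ^ (-1 / γ))) ((y - 1) / γ) :=
      ((h1.rpow_const (Or.inl (by rw [e]; exact hy.ne'))).neg).rexp
    refine h2.congr ?_
    filter_upwards [h1.eventually (lt_mem_nhds (show 0 < 1 + γ * ((y - 1) / γ) by rw [e]; exact hy))]
      with x hx
    rw [evCdf, if_neg hγ.ne', if_pos hx]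
  have hdy : ∀ y : ℝ, 0 < y → Tendsto (fun k : ℕ => (2 : ℝ) ^ k *
      (1 - distrib μ (a (2 ^ k) / γ * y + (b (2 ^ k) - a (2 ^ k) / γ)))) atTop
      (𝓝 (y ^ (-1 / γ))) := by
    intro y hy
    have h1 := hab _ (hcont y hy)
    rw [hG y hy] at h1
    have h2 := (aux_log (fun n => hnn _) h1).comp (tendsto_pow_atTop_atTop_of_one_lt (one_lt_two (α := ℕ)))
    refine h2.congr fun k => ?_
    simp only [Function.comp, Nat.cast_pow, Nat.cast_ofNat]
    congr 3
    field_simp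
    ring
  obtain ⟨h1, h2⟩ := aux_core hS hp (A := fun k => a (2 ^ k) / γ)
    (B := fun k => b (2 ^ k) - a (2 ^ k) / γ) (fun k => div_pos (ha _) hγ) hdy
  refine ⟨?_, (2 : ℝ) ^ (-1 / γ), ⟨by positivity, Real.rpow_lt_one_of_one_lt_of_neg one_lt_two hp⟩, h2⟩
  rw [rightEndpoint, EReal.eq_top_iff_forall_lt]
  intro t
  refine (EReal.coe_lt_coe_iff.2 (lt_add_one t)).trans_le (le_sSup ⟨t + 1, ?_, rfl⟩)
  have := h1 (t + 1)
  show distrib μ (t + 1) < 1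
  linarith
end
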